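/- arXiv:2405.03617 — 2 statements merged into one kernel-verified Lean document; each statement's English description precedes it below -/
import Mathlib

section
/- Let a : ℝ → ℝ be continuously differentiable, let k₁ ∈ ℝ, and let u : ℝ × ℝ → ℝ be twice continuously differentiable. Suppose that for all (x,t), u_t(x,t) = a(u(x,t))·u_x(x,t) + k₁. Then u satisfies u_tt − a(u)²·u_xx = 2·a(u)·a'(u)·u_x² + k₁·a'(u)·u_x at every point (x,t). -/
/-- Partial derivative of `u(x,t)` with respect to the first argument `x`. -/
noncomputable def px (u : ℝ × ℝ → ℝ) (p : ℝ × ℝ) : ℝ := fderiv ℝ u p (1, 0)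

/-- Partial derivative of `u(x,t)` with respect to the second argument `t`. -/
noncomputable def pt (u : ℝ × ℝ → ℝ) (p : ℝ × ℝ) : ℝ := fderiv ℝ u p (0, 1)

/-- Fréchet derivative of the right-hand side `a(u)·u_x + k₁` of the first-order equation. -/
lemma hasFDerivAt_comp_mul_px_add_const {a : ℝ → ℝ} {u : ℝ × ℝ → ℝ} (k₁ : ℝ) {p : ℝ × ℝ}
    (ha : DifferentiableAt ℝ a (u p)) (hu : DifferentiableAt ℝ u p)
    (hpx : DifferentiableAt ℝ (px u) p) :
    HasFDerivAt (fun q => a (u q) * px u q + k₁)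
      (a (u p) • fderiv ℝ (px u) p + px u p • deriv a (u p) • fderiv ℝ u p) p :=
  ((ha.hasDerivAt.comp_hasFDerivAt p hu.hasFDerivAt).mul hpx.hasFDerivAt).add_const k₁

/-- Equality of mixed partial derivatives for a `C²` function. -/
lemma pt_px_eq_px_pt {u : ℝ × ℝ → ℝ} (hu : ContDiff ℝ 2 u) (p : ℝ × ℝ) :
    pt (px u) p = px (pt u) p := by
  have hd : DifferentiableAt ℝ (fderiv ℝ u) p :=
    (hu.fderiv_right (m := 1) (by norm_num)).differentiable one_ne_zero p
  have hsymm : IsSymmSndFDerivAt ℝ u p := hu.contDiffAt.isSymmSndFDerivAt (by simp)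
  have hx : fderiv ℝ (px u) p (0, 1) = fderiv ℝ (fderiv ℝ u) p (0, 1) (1, 0) := by
    unfold px
    simpa using congrArg (· (0, 1)) (hd.hasFDerivAt.clm_apply (hasFDerivAt_const (1, 0) p)).fderiv
  have ht : fderiv ℝ (pt u) p (1, 0) = fderiv ℝ (fderiv ℝ u) p (1, 0) (0, 1) := by
    unfold pt
    simpa using congrArg (· (1, 0)) (hd.hasFDerivAt.clm_apply (hasFDerivAt_const (0, 1) p)).fderiv
  exact hx.trans ((hsymm.eq _ _).trans ht.symm)

/-- If `u_t = a(u)·u_x + k₁`, then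
`u_tt − a(u)²·u_xx = 2·a(u)·a'(u)·u_x² + k₁·a'(u)·u_x`. -/
theorem wave_with_constant_source_intermediate_integral
    (a : ℝ → ℝ) (k₁ : ℝ) (u : ℝ × ℝ → ℝ)
    (ha : ContDiff ℝ 1 a) (hu : ContDiff ℝ 2 u)
    (heq : ∀ x t : ℝ, pt u (x, t) = a (u (x, t)) * px u (x, t) + k₁) :
    ∀ x t : ℝ,
      pt (pt u) (x, t) - (a (u (x, t)))^2 * px (px u) (x, t) =
        2 * a (u (x, t)) * deriv a (u (x, t)) * (px u (x, t))^2
          + k₁ * deriv a (u (x, t)) * px u (x, t) := by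
  intro x t
  have hpx : Differentiable ℝ (px u) :=
    ((hu.fderiv_right (m := 1) (by norm_num)).clm_apply contDiff_const).differentiable one_ne_zero
  have hfun : pt u = fun q => a (u q) * px u q + k₁ := funext fun q => heq q.1 q.2
  have hD := (hasFDerivAt_comp_mul_px_add_const k₁ (ha.differentiable one_ne_zero _)
    (hu.differentiable two_ne_zero _) (hpx (x, t))).fderiv
  rw [← hfun] at hD
  have htt : pt (pt u) (x, t) = a (u (x, t)) * pt (px u) (x, t)
      + px u (x, t) * (deriv a (u (x, t)) * pt u (x, t)) :=
    congrArg (· (0, 1)) hD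
  have hxt : px (pt u) (x, t) = a (u (x, t)) * px (px u) (x, t)
      + px u (x, t) * (deriv a (u (x, t)) * px u (x, t)) :=
    congrArg (· (1, 0)) hD
  rw [htt, pt_px_eq_px_pt hu, hxt, heq]
  ring
end

section
/- Let c₀ ∈ ℝ. Then for all twice continuously differentiable F, G : ℝ → ℝ, the function u(x,t) = e^{−(c₀/4)·t}·( e^{(c₀/4)·x}·F(x + t) + e^{−(c₀/4)·x}·G(x − t) ) satisfies the damped wave equation u_tt − u_xx = −c₀·u_t − (c₀²/4)·u at every point (x,t) ∈ ℝ × ℝ. -/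
/-- The superposition of the two damped travelling profiles `F` and `G` with rate `a`. -/
noncomputable def dampedWave (a : ℝ) (F G : ℝ → ℝ) (p : ℝ × ℝ) : ℝ :=
  Real.exp (-a * p.2) * (Real.exp (a * p.1) * F (p.1 + p.2) + Real.exp (-a * p.1) * G (p.1 - p.2))

theorem differentiableAt_dampedWave (a : ℝ) {F G : ℝ → ℝ} (hF : Differentiable ℝ F)
    (hG : Differentiable ℝ G) (p : ℝ × ℝ) : DifferentiableAt ℝ (dampedWave a F G) p := by
  unfold dampedWave
  fun_prop

theorem px_dampedWave (a : ℝ) {F G : ℝ → ℝ} (hF : Differentiable ℝ F) (hG : Differentiable ℝ G) :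
    px (dampedWave a F G) =
      dampedWave a (fun s => a * F s + deriv F s) (fun s => -a * G s + deriv G s) := by
  funext ⟨x, t⟩
  have hline : HasDerivAt (fun s : ℝ => (s, t)) ((1 : ℝ), (0 : ℝ)) x :=
    (hasDerivAt_id x).prodMk (hasDerivAt_const x t)
  have hchain := (differentiableAt_dampedWave a hF hG (x, t)).hasFDerivAt.comp_hasDerivAt x hline
  have hexp (b : ℝ) : HasDerivAt (fun s => Real.exp (b * s)) (Real.exp (b * x) * (b * 1)) x :=
    ((hasDerivAt_id x).const_mul b).exp
  have hFx : HasDerivAt (fun s => F (s + t)) (deriv F (x + t)) x :=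
    (hF (x + t)).hasDerivAt.comp_add_const x t
  have hGx : HasDerivAt (fun s => G (s - t)) (deriv G (x - t)) x :=
    (hG (x - t)).hasDerivAt.comp_sub_const x t
  have hdirect := (((hexp a).mul hFx).add ((hexp (-a)).mul hGx)).const_mul (Real.exp (-a * t))
  refine (hchain.unique hdirect).trans ?_
  simp only [dampedWave]
  ring

theorem pt_dampedWave (a : ℝ) {F G : ℝ → ℝ} (hF : Differentiable ℝ F) (hG : Differentiable ℝ G) :
    pt (dampedWave a F G) =
      dampedWave a (fun s => -a * F s + deriv F s) (fun s => -a * G s - deriv G s) := by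
  funext ⟨x, t⟩
  have hline : HasDerivAt (fun s : ℝ => (x, s)) ((0 : ℝ), (1 : ℝ)) t :=
    (hasDerivAt_const t x).prodMk (hasDerivAt_id t)
  have hchain := (differentiableAt_dampedWave a hF hG (x, t)).hasFDerivAt.comp_hasDerivAt t hline
  have hexp : HasDerivAt (fun s => Real.exp (-a * s)) (Real.exp (-a * t) * (-a * 1)) t :=
    ((hasDerivAt_id t).const_mul (-a)).exp
  have hFt : HasDerivAt (fun s => F (x + s)) (deriv F (x + t)) t :=
    (hF (x + t)).hasDerivAt.comp_const_add x t
  have hGt : HasDerivAt (fun s => G (x - s)) (-deriv G (x - t)) t :=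
    (hG (x - t)).hasDerivAt.comp_const_sub x t
  have hdirect := hexp.mul
    ((hFt.const_mul (Real.exp (a * x))).add (hGt.const_mul (Real.exp (-a * x))))
  refine (hchain.unique hdirect).trans ?_
  simp only [dampedWave, Pi.add_apply]
  ring

/-- The function `u(x,t) = e^{−(c₀/4)t}(e^{(c₀/4)x}F(x + t) + e^{−(c₀/4)x}G(x − t))`
solves the damped wave equation `u_tt − u_xx = −c₀u_t − (c₀²/4)u`. -/
theorem damped_wave_general_solution
    (c₀ : ℝ)
    (F G : ℝ → ℝ) (hF : ContDiff ℝ 2 F) (hG : ContDiff ℝ 2 G)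
    (u : ℝ × ℝ → ℝ)
    (hu : ∀ x t : ℝ,
      u (x, t) = Real.exp (-(c₀ / 4) * t) *
        (Real.exp ((c₀ / 4) * x) * F (x + t)
          + Real.exp (-(c₀ / 4) * x) * G (x - t))) :
    ∀ x t : ℝ,
      pt (pt u) (x, t) - px (px u) (x, t) =
        -c₀ * pt u (x, t) - (c₀^2 / 4) * u (x, t) := by
  obtain rfl : u = dampedWave (c₀ / 4) F G := funext fun p => hu p.1 p.2
  intro x t
  have hF₁ : Differentiable ℝ F := hF.differentiable two_ne_zero
  have hG₁ : Differentiable ℝ G := hG.differentiable two_ne_zero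
  have hF₂ : Differentiable ℝ (deriv F) := hF.differentiable_deriv_two
  have hG₂ : Differentiable ℝ (deriv G) := hG.differentiable_deriv_two
  have hdF (b : ℝ) : deriv (fun s => b * F s + deriv F s) =
      fun s => b * deriv F s + deriv (deriv F) s :=
    funext fun s => (((hF₁ s).hasDerivAt.const_mul b).add (hF₂ s).hasDerivAt).deriv
  have hdG (b : ℝ) : deriv (fun s => b * G s + deriv G s) =
      fun s => b * deriv G s + deriv (deriv G) s :=
    funext fun s => (((hG₁ s).hasDerivAt.const_mul b).add (hG₂ s).hasDerivAt).deriv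
  have hdG' (b : ℝ) : deriv (fun s => b * G s - deriv G s) =
      fun s => b * deriv G s - deriv (deriv G) s :=
    funext fun s => (((hG₁ s).hasDerivAt.const_mul b).sub (hG₂ s).hasDerivAt).deriv
  rw [pt_dampedWave _ hF₁ hG₁, px_dampedWave _ hF₁ hG₁,
    pt_dampedWave _ (by fun_prop) (by fun_prop), px_dampedWave _ (by fun_prop) (by fun_prop)]
  simp only [hdF, hdG, hdG', dampedWave]
  ring
end
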